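/- In the category 𝒜_S of finite-dimensional k-vector spaces whose dimension lies in the submonoid S = ℕ \ {1}, equipped with the split exact structure, the ℰ-simple objects are exactly the spaces of dimension 2 and 3, up to isomorphism. -/

import Mathlib

/-- In the category `𝒜_S` of finite-dimensional `k`-vector spaces whose dimension
lies in `S = ℕ \ {1}`, equipped with the split exact structure (so that
`X ⊆_ℰ V` means `V ≅ X ⊕ Z` for some `Z` in `𝒜_S`), the `ℰ`-simple objects are
exactly the spaces of dimension `2` and `3`. -/
theorem eSimple_iff_dim_two_or_three (k : Type) [Field k]
    (V : Type) [AddCommGroup V] [Module k V] [FiniteDimensional k V]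
    (hV : Module.finrank k V ≠ 1) :
    (Nontrivial V ∧
      ∀ (X Z : Type) [AddCommGroup X] [Module k X] [FiniteDimensional k X]
        [AddCommGroup Z] [Module k Z] [FiniteDimensional k Z],
        Module.finrank k X ≠ 1 → Module.finrank k Z ≠ 1 →
        Nonempty (V ≃ₗ[k] X × Z) →
        Subsingleton X ∨ Nonempty (X ≃ₗ[k] V)) ↔
    (Module.finrank k V = 2 ∨ Module.finrank k V = 3) := by
  constructor
  · rintro ⟨hn, h⟩
    have hpos : 0 < Module.finrank k V := Module.finrank_pos
    by_contra hc
    have e : Nonempty (V ≃ₗ[k] (Fin 2 → k) × (Fin (Module.finrank k V - 2) → k)) := by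
      apply FiniteDimensional.nonempty_linearEquiv_of_finrank_eq
      rw [Module.finrank_prod, Module.finrank_fin_fun, Module.finrank_fin_fun]
      omega
    rcases h (Fin 2 → k) (Fin (Module.finrank k V - 2) → k)
      (by rw [Module.finrank_fin_fun]; omega) (by rw [Module.finrank_fin_fun]; omega) e with h1 | h2
    · exact not_subsingleton (Fin 2 → k) h1
    · obtain ⟨f⟩ := h2
      have := f.finrank_eq
      rw [Module.finrank_fin_fun] at this
      omega
  · intro h
    refine ⟨Module.nontrivial_of_finrank_pos (R := k) (by omega), ?_⟩
    intro X Z _ _ _ _ _ _ hX hZ ⟨e⟩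
    have he := e.finrank_eq
    rw [Module.finrank_prod] at he
    by_cases h0 : Module.finrank k X = 0
    · exact Or.inl (Module.finrank_zero_iff.mp h0)
    · exact Or.inr (FiniteDimensional.nonempty_linearEquiv_of_finrank_eq (by omega))
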